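/- For all natural numbers n and t with n ≥ t + 1, the sum over all k of the falling factorial [k]_{t+1} = k(k-1)···(k-t) times f_n(k) equals n!, where f_n(k) is the number of permutations of an n-element set with exactly k fixed points. -/

import Mathlib

/-- `f n k` is the number of permutations of an `n`-element set with exactly `k`
fixed points. -/
def numPermsWithFixedPoints (n k : ℕ) : ℕ :=
  ((Finset.univ : Finset (Equiv.Perm (Fin n))).filter
    (fun σ => (Finset.univ.filter fun i => σ i = i).card = k)).card

/-- The embeddings `ι ↪ α` fixed by a permutation `σ` of `α` are the embeddings of `ι` into the
set of fixed points of `σ`. -/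
def embeddingFixedByEquiv {α : Type*} (ι : Type*) (σ : Equiv.Perm α) :
    MulAction.fixedBy (ι ↪ α) σ ≃ (ι ↪ {a // σ a = a}) where
  toFun e := Function.Embedding.codRestrict {a | σ a = a} e.1 fun i => DFunLike.congr_fun e.2 i
  invFun e := ⟨e.trans (Function.Embedding.subtype _), by ext i; exact (e i).2⟩
  left_inv _ := rfl
  right_inv _ := rfl

/-- The factorial moments of the number of fixed points of a permutation. -/
theorem sum_perm_descFactorial_card_fixed {α : Type*} [Fintype α] [DecidableEq α] (m : ℕ)
    (h : m ≤ Fintype.card α) :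
    ∑ σ : Equiv.Perm α, (Finset.univ.filter fun a => σ a = a).card.descFactorial m =
      (Fintype.card α).factorial := by
  classical
  have hpre : MulAction.IsPretransitive (Equiv.Perm α) (Fin m ↪ α) :=
    Equiv.Perm.isMultiplyPretransitive α m
  obtain ⟨e⟩ : Nonempty (Fin m ↪ α) :=
    Function.Embedding.nonempty_of_card_le (by simpa using h)
  have : Unique (Quotient (MulAction.orbitRel (Equiv.Perm α) (Fin m ↪ α))) :=
    { default := Quotient.mk _ e
      uniq := fun q => q.inductionOn fun x =>
        Quotient.sound (MulAction.exists_smul_eq (Equiv.Perm α) e x) }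
  have burnside := MulAction.sum_card_fixedBy_eq_card_orbits_mul_card_group
    (Equiv.Perm α) (Fin m ↪ α)
  rw [Fintype.card_unique, one_mul, Fintype.card_perm] at burnside
  rw [← burnside]
  refine Finset.sum_congr rfl fun σ _ => ?_
  rw [Fintype.card_congr (embeddingFixedByEquiv (Fin m) σ), Fintype.card_embedding_eq,
    Fintype.card_fin, Fintype.card_subtype]

/-- For `n ≥ t + 1`, `∑_k [k]_{t+1} f_n(k) = n!`, where `[k]_{t+1} = k(k-1)⋯(k-t)`
is the falling factorial. -/
theorem sum_descFactorial_mul_numPermsWithFixedPoints (n t : ℕ) (h : t + 1 ≤ n) :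
    ∑ k ∈ Finset.range (n + 1),
      k.descFactorial (t + 1) * numPermsWithFixedPoints n k = n.factorial := by
  have key := sum_perm_descFactorial_card_fixed (α := Fin n) (t + 1) (by simpa using h)
  rw [Fintype.card_fin] at key
  have hmaps : ∀ σ ∈ (Finset.univ : Finset (Equiv.Perm (Fin n))),
      (Finset.univ.filter fun i => σ i = i).card ∈ Finset.range (n + 1) := fun σ _ =>
    Finset.mem_range_succ_iff.2 ((Finset.card_le_univ _).trans_eq (Fintype.card_fin n))
  rw [← key, ← Finset.sum_fiberwise_of_maps_to hmaps]
  refine Finset.sum_congr rfl fun k _ => ?_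
  rw [numPermsWithFixedPoints, Finset.sum_congr rfl fun σ hσ => by
    rw [(Finset.mem_filter.1 hσ).2], Finset.sum_const, smul_eq_mul, mul_comm]
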